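/- Let Γ = ⟨a,b,c,d | b², c², d², cdcd, ada⁻¹c, aca⁻¹d, bcbd⟩ with generating set S = {a, a⁻¹, b, c, d}, and let D̃ denote its Cayley diagram. Let ε > 0, let H be a finite 3-regular graph in which every independent set has at most (1/2 − ε)·|V(H)| vertices, and let ℓ be any S-diagram structure on the box product H □ C₄. Then for every R ≥ 4, the number of vertices x of H □ C₄ that are R-good — i.e., such that there exists a rooted labelled-isomorphism from the labelled rooted R-ball of (H □ C₄, ℓ) at x to the labelled rooted R-ball of D̃ at the identity — is at most (1 − 2ε)·|V(H □ C₄)|. -/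

import Mathlib

open Filter Topology SimpleGraph
open scoped Classical

/-- The Cayley graph of a group with respect to a set `S`:
`x` and `y` are adjacent iff `x⁻¹ * y ∈ S` or `y⁻¹ * x ∈ S` (and `x ≠ y`,
which is automatic when `1 ∉ S`). -/
def cayley {Γ : Type*} [Group Γ] (S : Set Γ) : SimpleGraph Γ :=
  SimpleGraph.fromRel (fun x y => x⁻¹ * y ∈ S)

/-- The set of vertices at graph distance at most `r` from `x`. -/
def ballSet {V : Type*} (G : SimpleGraph V) (x : V) (r : ℕ) : Set V :=
  {y | ∃ w : G.Walk x y, w.length ≤ r}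

lemma self_mem_ballSet {V : Type*} (G : SimpleGraph V) (x : V) (r : ℕ) :
    x ∈ ballSet G x r := ⟨SimpleGraph.Walk.nil, by simp⟩

/-- The rooted `r`-ball of `G` at `x` is rooted-isomorphic to the rooted `r`-ball
of `H` at `y`. -/
def RootedBallIso {V W : Type*} (G : SimpleGraph V) (x : V)
    (H : SimpleGraph W) (y : W) (r : ℕ) : Prop :=
  ∃ f : G.induce (ballSet G x r) ≃g H.induce (ballSet H y r),
    (f ⟨x, self_mem_ballSet G x r⟩).1 = y

/-- The proportion of vertices of a finite graph `G` whose rooted `r`-ball is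
rooted-isomorphic to the rooted `r`-ball of `H` at `y`. -/
noncomputable def ballIsoProportion {V W : Type*} [Fintype V] (G : SimpleGraph V)
    (H : SimpleGraph W) (y : W) (r : ℕ) : ℝ :=
  (Nat.card {x : V // RootedBallIso G x H y r} : ℝ) / (Fintype.card V : ℝ)

/-- Benjamini–Schramm convergence of a sequence of finite graphs to a fixed
(vertex-transitive) graph `H` rooted at `o`: for every `r`, the proportion of
vertices whose rooted `r`-ball is rooted-isomorphic to the `r`-ball of `H` at `o`
tends to `1`. -/
def BSLimit {V : ℕ → Type*} [∀ n, Fintype (V n)] (G : ∀ n, SimpleGraph (V n))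
    {W : Type*} (H : SimpleGraph W) (o : W) : Prop :=
  ∀ r : ℕ, Tendsto (fun n => ballIsoProportion (G n) H o r) atTop (𝓝 1)

/-- An `S`-diagram structure on a graph `G`: each edge carries a label from `S`
together with an orientation (`label x y = some s` means the edge `{x, y}` carries
label `s` oriented from `x` to `y`); if the inverse of the label also lies in `S`,
the reverse direction carries the inverse label; in particular edges labelled by an
involutive generator are unoriented (labelled the same in both directions). -/
structure DiagramStruct {V : Type*} {Γ : Type*} [Group Γ] (G : SimpleGraph V)
    (S : Set Γ) where
  label : V → V → Option Γ
  label_mem : ∀ x y s, label x y = some s → s ∈ S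
  label_inv : ∀ x y s, label x y = some s → s⁻¹ ∈ S → label y x = some s⁻¹
  adj_iff : ∀ x y, G.Adj x y ↔ ((label x y).isSome ∨ (label y x).isSome)

/-- The labelling of the Cayley diagram of `(Γ, S)`: for each `s ∈ S`, the edge
`{x, x * s}` is labelled `s` and oriented from `x` to `x * s`. -/
noncomputable def cayleyLabel {Γ : Type*} [Group Γ] (S : Set Γ) : Γ → Γ → Option Γ :=
  fun x y => if x⁻¹ * y ∈ S then some (x⁻¹ * y) else none

/-- There is a rooted labelled-isomorphism from the labelled rooted `r`-ball of
`(G, ℓ)` at `x` to the labelled rooted `r`-ball of `(H, m)` at `y`: a rooted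
isomorphism of the underlying rooted balls preserving labels and orientations. -/
def LabelledBallIso {V W Γ : Type*} (G : SimpleGraph V) (ℓ : V → V → Option Γ) (x : V)
    (H : SimpleGraph W) (m : W → W → Option Γ) (y : W) (r : ℕ) : Prop :=
  ∃ f : G.induce (ballSet G x r) ≃g H.induce (ballSet H y r),
    (f ⟨x, self_mem_ballSet G x r⟩).1 = y ∧
    ∀ u v : ballSet G x r, ℓ u.1 v.1 = m (f u).1 (f v).1

/-- The cycle graph on 4 vertices. -/
def C4 : SimpleGraph (ZMod 4) := SimpleGraph.fromRel (fun x y => y = x + 1)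

/-- The free-group letters `a, b, c, d`. -/
private def fa : FreeGroup (Fin 4) := FreeGroup.of 0
private def fb : FreeGroup (Fin 4) := FreeGroup.of 1
private def fc : FreeGroup (Fin 4) := FreeGroup.of 2
private def fd : FreeGroup (Fin 4) := FreeGroup.of 3

/-- The relators `b², c², d², cdcd, ada⁻¹c, aca⁻¹d, bcbd`. -/
def rels : Set (FreeGroup (Fin 4)) :=
  {fb ^ 2, fc ^ 2, fd ^ 2, fc * fd * fc * fd, fa * fd * fa⁻¹ * fc,
    fa * fc * fa⁻¹ * fd, fb * fc * fb * fd}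

/-- The group `Γ = ⟨a,b,c,d | b², c², d², cdcd, ada⁻¹c, aca⁻¹d, bcbd⟩`. -/
abbrev Γp : Type := PresentedGroup rels

/-- The images of the generating symbols `a, b, c, d` in `Γ`. -/
def ga : Γp := PresentedGroup.of 0
def gb : Γp := PresentedGroup.of 1
def gc : Γp := PresentedGroup.of 2
def gd : Γp := PresentedGroup.of 3

/-- The generating set `S = {a, a⁻¹, b, c, d}` of `Γ`. -/
def SΓ : Set Γp := {ga, ga⁻¹, gb, gc, gd}

/-- The generators `a, a⁻¹, b, c, d` of `Γ`, indexed by `Fin 5`. -/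
def gen : Fin 5 → Γp := ![ga, ga⁻¹, gb, gc, gd]

/-- The index of the inverse generator. -/
def invIdx : Fin 5 → Fin 5 := ![1, 0, 2, 3, 4]

/-- The involution of indices exchanging `c` and `d`. -/
def swapIdx : Fin 5 → Fin 5 := ![0, 1, 2, 4, 3]

/-- Images of `a, b, c, d` in a finite quotient of `Γ` separating the `2`-ball. -/
def permGen : Fin 4 → Equiv.Perm (Fin 4) × Equiv.Perm (Fin 4) :=
  ![(Equiv.swap 0 1 * Equiv.swap 1 2, Equiv.swap 1 2), (Equiv.swap 2 3, Equiv.swap 1 2),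
    (1, Equiv.swap 0 1 * Equiv.swap 2 3), (1, Equiv.swap 0 2 * Equiv.swap 1 3)]

lemma lift_permGen_eq_one : ∀ r ∈ rels, FreeGroup.lift permGen r = 1 := by
  intro r hr
  simp only [rels, Set.mem_insert_iff, Set.mem_singleton_iff] at hr
  rcases hr with rfl | rfl | rfl | rfl | rfl | rfl | rfl <;>
    simp only [fa, fb, fc, fd, map_mul, map_pow, map_inv, FreeGroup.lift_apply_of] <;> decide

/-- The homomorphism from `Γ` to the finite quotient given by `permGen`. -/
def toPerm : Γp →* Equiv.Perm (Fin 4) × Equiv.Perm (Fin 4) :=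
  PresentedGroup.toGroup lift_permGen_eq_one

/-- Images of the generators `a, a⁻¹, b, c, d` in the finite quotient. -/
def permGen5 : Fin 5 → Equiv.Perm (Fin 4) × Equiv.Perm (Fin 4) :=
  ![permGen 0, (permGen 0)⁻¹, permGen 1, permGen 2, permGen 3]

lemma toPerm_gen (k : Fin 5) : toPerm (gen k) = permGen5 k := by
  have h (i : Fin 4) : toPerm (PresentedGroup.of i) = permGen i :=
    PresentedGroup.toGroup.of lift_permGen_eq_one
  fin_cases k <;> simp [gen, permGen5, ga, gb, gc, gd, h]

lemma gen_injective : Function.Injective gen := by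
  have h : ∀ i j, permGen5 i = permGen5 j → i = j := by decide +kernel
  intro i j hij
  exact h i j (by rw [← toPerm_gen, hij, toPerm_gen])

lemma gen_ne_one (k : Fin 5) : gen k ≠ 1 := by
  have h : ∀ i, permGen5 i ≠ 1 := by decide +kernel
  intro hk
  exact h k (by rw [← toPerm_gen, hk, map_one])

lemma gen_invIdx (k : Fin 5) : gen (invIdx k) = (gen k)⁻¹ := by
  have hrel {r} (hr : r ∈ rels) : PresentedGroup.mk rels r = 1 := PresentedGroup.one_of_mem hr
  have hb : gb ^ 2 = 1 := hrel (r := fb ^ 2) (by simp [rels])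
  have hc : gc ^ 2 = 1 := hrel (r := fc ^ 2) (by simp [rels])
  have hd : gd ^ 2 = 1 := hrel (r := fd ^ 2) (by simp [rels])
  rw [pow_two] at hb hc hd
  have hb' := eq_inv_of_mul_eq_one_left hb
  have hc' := eq_inv_of_mul_eq_one_left hc
  have hd' := eq_inv_of_mul_eq_one_left hd
  fin_cases k <;> simp [gen, invIdx, ← hb', ← hc', ← hd']

lemma mem_SΓ_iff (s : Γp) : s ∈ SΓ ↔ ∃ k, s = gen k := by
  simp [SΓ, gen, Fin.exists_fin_succ]

/-- The nondegenerate `4`-cycles through `1` in the Cayley graph of `Γ`. -/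
lemma square_cases {i j k l : Fin 5} (h : gen i * gen j = gen k * gen l) (hik : i ≠ k)
    (hij : j ≠ invIdx i) : (3 ≤ i ∨ 3 ≤ k) ∧ (i < 3 → j = swapIdx k) ∧
      (3 ≤ i → 3 ≤ k → j = k ∧ l = i ∧ k = swapIdx i) := by
  have key : ∀ i j k l : Fin 5, permGen5 i * permGen5 j = permGen5 k * permGen5 l → i ≠ k →
      j ≠ invIdx i → (3 ≤ i ∨ 3 ≤ k) ∧ (i < 3 → j = swapIdx k) ∧
      (3 ≤ i → 3 ≤ k → j = k ∧ l = i ∧ k = swapIdx i) := by decide +kernel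
  exact key i j k l (by simp only [← toPerm_gen, ← map_mul, h]) hik hij

lemma cayley_adj_mul_gen (x : Γp) (k : Fin 5) : (cayley SΓ).Adj x (x * gen k) := by
  have := gen_ne_one k
  simp [cayley, mem_SΓ_iff, this]

lemma exists_gen_of_cayley_adj {x y : Γp} (h : (cayley SΓ).Adj x y) : ∃ k, y = x * gen k := by
  simp only [cayley, SimpleGraph.fromRel_adj, mem_SΓ_iff] at h
  obtain ⟨-, ⟨k, hk⟩ | ⟨k, hk⟩⟩ := h
  · exact ⟨k, by rw [← hk]; group⟩
  · exact ⟨invIdx k, by rw [gen_invIdx, ← hk]; group⟩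

lemma cayleyLabel_mul_gen (x : Γp) (k : Fin 5) :
    cayleyLabel SΓ x (x * gen k) = some (gen k) := by
  simp [cayleyLabel, mem_SΓ_iff]

lemma mem_ballSet_of_adj {W : Type*} {G : SimpleGraph W} {x y z : W} {n : ℕ}
    (hy : y ∈ ballSet G x n) (h : G.Adj y z) : z ∈ ballSet G x (n + 1) := by
  obtain ⟨w, hw⟩ := hy
  exact ⟨w.concat h, by simpa using hw⟩

lemma ballSet_mono {W : Type*} (G : SimpleGraph W) (x : W) {m n : ℕ} (h : m ≤ n) :
    ballSet G x m ⊆ ballSet G x n :=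
  fun _ ⟨w, hw⟩ => ⟨w, hw.trans h⟩

/-- A labelled ball isomorphism as a map defined on the whole vertex set. -/
lemma LabelledBallIso.exists_map {W : Type*} {G : SimpleGraph W} {m : W → W → Option Γp} {x : W}
    {R : ℕ} (hR : 1 ≤ R) (h : LabelledBallIso G m x (cayley SΓ) (cayleyLabel SΓ) 1 R) :
    ∃ F : W → Γp, F x = 1 ∧ Set.InjOn F (ballSet G x R) ∧
      (∀ u ∈ ballSet G x R, ∀ v ∈ ballSet G x R, G.Adj u v →
        ∃ k, F v = F u * gen k) ∧
      (∀ u ∈ ballSet G x R, ∀ v ∈ ballSet G x R, ∀ k, F v = F u * gen k →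
        m u v = some (gen k)) ∧
      ∀ k, ∃ z, G.Adj x z ∧ F z = gen k := by
  obtain ⟨f, hx, hm⟩ := h
  have hF {u} (hu : u ∈ ballSet G x R) :
      (fun u => if hu : u ∈ ballSet G x R then (f ⟨u, hu⟩).1 else 1) u = (f ⟨u, hu⟩).1 :=
    dif_pos hu
  refine ⟨fun u => if hu : u ∈ ballSet G x R then (f ⟨u, hu⟩).1 else 1, ?_, ?_, ?_, ?_, ?_⟩
  · rw [hF (self_mem_ballSet G x R), hx]
  · intro u hu v hv huv
    rw [hF hu, hF hv] at huv
    simpa using f.injective (Subtype.ext huv)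
  · intro u hu v hv huv
    rw [hF hu, hF hv]
    exact exists_gen_of_cayley_adj (f.map_rel_iff.2 (show (G.induce _).Adj ⟨u, hu⟩ ⟨v, hv⟩ from huv))
  · intro u hu v hv k hk
    rw [hF hu, hF hv] at hk
    rw [hm ⟨u, hu⟩ ⟨v, hv⟩, hk, cayleyLabel_mul_gen]
  · intro k
    have hadj : (cayley SΓ).Adj 1 (gen k) := by simpa using cayley_adj_mul_gen 1 k
    have hk : gen k ∈ ballSet (cayley SΓ) 1 R :=
      ballSet_mono _ _ hR (mem_ballSet_of_adj (self_mem_ballSet _ _ 0) hadj)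
    obtain ⟨⟨z, hz⟩, hfz⟩ := f.surjective ⟨gen k, hk⟩
    refine ⟨z, ?_, by rw [hF hz, hfz]⟩
    have : (G.induce (ballSet G x R)).Adj ⟨x, self_mem_ballSet G x R⟩ ⟨z, hz⟩ := by
      rw [← f.map_rel_iff, hfz]
      simpa [hx] using hadj
    exact this

lemma C4_adj_iff (i j : ZMod 4) : C4.Adj i j ↔ j = i + 1 ∨ j = i + 3 := by
  simp only [C4, SimpleGraph.fromRel_adj]
  revert i j
  decide

lemma boxProd_C4_adj_vertical {V : Type*} (H : SimpleGraph V) (h : V) (i j : ZMod 4) :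
    (H □ C4).Adj (h, i) (h, j) ↔ j = i + 1 ∨ j = i + 3 := by
  simp [SimpleGraph.boxProd_adj, C4_adj_iff]

/-- The fibre through a good vertex is labelled alternately by `c` and `d`, and the labels on the
adjacent fibres are swapped. -/
lemma LabelledBallIso.fibre_labels {V : Type*} {H : SimpleGraph V}
    {m : V × ZMod 4 → V × ZMod 4 → Option Γp} {h : V} {i : ZMod 4} {R : ℕ} (hR : 4 ≤ R)
    (hg : LabelledBallIso (H □ C4) m (h, i) (cayley SΓ) (cayleyLabel SΓ) 1 R) :
    ∃ k : Fin 5, 3 ≤ k ∧ m (h, i) (h, i + 1) = some (gen k) ∧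
      m (h, i + 1) (h, i + 2) = some (gen (swapIdx k)) ∧
      m (h, i + 2) (h, i + 3) = some (gen k) ∧
      m (h, i + 3) (h, i) = some (gen (swapIdx k)) ∧
      ∀ h', H.Adj h h' → m (h', i) (h', i + 1) = some (gen (swapIdx k)) := by
  obtain ⟨F, hF1, hinj, hadj, hlab, hsurj⟩ := hg.exists_map (by omega)
  have hball0 := self_mem_ballSet (H □ C4) (h, i) R
  have ball1 {y} (hy : (H □ C4).Adj (h, i) y) : y ∈ ballSet (H □ C4) (h, i) R :=
    ballSet_mono _ _ (by omega) (mem_ballSet_of_adj (self_mem_ballSet _ _ 0) hy)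
  have ball2 {y w} (hy : (H □ C4).Adj (h, i) y) (hw : (H □ C4).Adj y w) :
      w ∈ ballSet (H □ C4) (h, i) R :=
    ballSet_mono _ _ (by omega)
      (mem_ballSet_of_adj (mem_ballSet_of_adj (self_mem_ballSet _ _ 0) hy) hw)
  have nbr {y} (hy : (H □ C4).Adj (h, i) y) : ∃ k, F y = gen k := by
    simpa [hF1] using hadj _ hball0 _ (ball1 hy) hy
  have square {y z w} {p q : Fin 5} (hy : (H □ C4).Adj (h, i) y) (hz : (H □ C4).Adj (h, i) z)
      (hyw : (H □ C4).Adj y w) (hzw : (H □ C4).Adj z w) (hyz : y ≠ z) (hw : w ≠ (h, i))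
      (hp : F y = gen p) (hq : F z = gen q) :
      ∃ j l, F w = F y * gen j ∧ F w = F z * gen l ∧ (3 ≤ p ∨ 3 ≤ q) ∧ (p < 3 → j = swapIdx q) ∧
        (3 ≤ p → 3 ≤ q → j = q ∧ l = p ∧ q = swapIdx p) := by
    obtain ⟨j, hj⟩ := hadj _ (ball1 hy) _ (ball2 hy hyw) hyw
    obtain ⟨l, hl⟩ := hadj _ (ball1 hz) _ (ball2 hy hyw) hzw
    refine ⟨j, l, hj, hl, square_cases (by rw [← hp, ← hq, ← hj, hl]) ?_ ?_⟩
    · rintro rfl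
      exact hyz (hinj (ball1 hy) (ball1 hz) (hp.trans hq.symm))
    · rintro rfl
      refine hw (hinj (ball2 hy hyw) hball0 ?_)
      rw [hj, hp, gen_invIdx, hF1, mul_inv_cancel]
  have two_step : ∀ i j : ZMod 4, j = i + 1 ∨ j = i + 3 → i + 2 = j + 1 ∨ i + 2 = j + 3 := by decide
  have vert (e : ZMod 4) (he : e = 1 ∨ e = 3) {p : Fin 5} (hp : F (h, i + e) = gen p) : 3 ≤ p := by
    by_contra! hlt
    have hy : (H □ C4).Adj (h, i) (h, i + e) := by
      rcases he with rfl | rfl <;> simp [SimpleGraph.boxProd_adj, C4_adj_iff]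
    obtain ⟨q, hq, hpq⟩ : ∃ q : Fin 5, q < 3 ∧ q ≠ p :=
      (by decide : ∀ p : Fin 5, ∃ q : Fin 5, q < 3 ∧ q ≠ p) p
    obtain ⟨z, hz, hFz⟩ := hsurj q
    have hyz : (h, i + e) ≠ z := by
      rintro rfl
      exact hpq (gen_injective (hFz.symm.trans hp))
    obtain ⟨w, hyw, hzw, hw⟩ : ∃ w, (H □ C4).Adj (h, i + e) w ∧ (H □ C4).Adj z w ∧
        w ≠ (h, i) := by
      obtain ⟨h', i'⟩ := z
      rw [SimpleGraph.boxProd_adj] at hz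
      rcases hz with ⟨hh, rfl⟩ | ⟨hi, rfl⟩
      · refine ⟨(h', i + e), ?_, ?_, ?_⟩
        · simpa [SimpleGraph.boxProd_adj] using hh
        · rcases he with rfl | rfl <;> simp [SimpleGraph.boxProd_adj, C4_adj_iff]
        · simp [(SimpleGraph.Adj.ne hh).symm]
      · refine ⟨(h, i + 2), ?_, ?_, ?_⟩
        · exact (boxProd_C4_adj_vertical H _ _ _).2
            (two_step i _ (by rcases he with rfl | rfl <;> simp))
        · exact (boxProd_C4_adj_vertical H _ _ _).2 (two_step i _ ((C4_adj_iff _ _).1 hi))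
        · simp; decide
    obtain ⟨-, -, -, -, h3, -⟩ := square hy hz hyw hzw hyz hw hp hFz
    omega
  have hy : (H □ C4).Adj (h, i) (h, i + 1) := by simp [SimpleGraph.boxProd_adj, C4_adj_iff]
  have hz : (H □ C4).Adj (h, i) (h, i + 3) := by simp [SimpleGraph.boxProd_adj, C4_adj_iff]
  have hyw : (H □ C4).Adj (h, i + 1) (h, i + 2) := by
    exact (boxProd_C4_adj_vertical H _ _ _).2 (two_step i _ (by simp))
  have hzw : (H □ C4).Adj (h, i + 3) (h, i + 2) := by
    exact (boxProd_C4_adj_vertical H _ _ _).2 (two_step i _ (by simp))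
  obtain ⟨p, hp⟩ := nbr hy
  obtain ⟨q, hq⟩ := nbr hz
  have hp3 := vert 1 (by simp) hp
  have hq3 := vert 3 (by simp) hq
  obtain ⟨j, l, hj, hl, -, -, hjl⟩ := square hy hz hyw hzw (by simp; decide) (by simp; decide) hp hq
  obtain ⟨rfl, rfl, rfl⟩ := hjl hp3 hq3
  have inv_self {k : Fin 5} (hk : 3 ≤ k) : gen k = (gen k)⁻¹ := by
    rw [← gen_invIdx]
    exact congrArg gen ((by decide : ∀ k : Fin 5, 3 ≤ k → k = invIdx k) k hk)
  refine ⟨l, hp3, hlab _ hball0 _ (ball1 hy) _ (by simp [hF1, hp]),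
    hlab _ (ball1 hy) _ (ball2 hy hyw) _ hj, hlab _ (ball2 hy hyw) _ (ball1 hz) _ ?_,
    hlab _ (ball1 hz) _ hball0 _ ?_, ?_⟩
  · rw [hl, mul_assoc]
    nth_rw 2 [inv_self hp3]
    simp
  · rw [hF1, hq]
    nth_rw 2 [inv_self hq3]
    simp
  · intro h' hh
    have hu : (H □ C4).Adj (h, i) (h', i) := by simpa [SimpleGraph.boxProd_adj] using hh
    have huv : (H □ C4).Adj (h', i) (h', i + 1) := by simp [SimpleGraph.boxProd_adj, C4_adj_iff]
    have hyv : (H □ C4).Adj (h, i + 1) (h', i + 1) := by simpa [SimpleGraph.boxProd_adj] using hh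
    obtain ⟨r, hr⟩ := nbr hu
    have hne1 : r ≠ l := by
      rintro rfl
      have := hinj (ball1 hu) (ball1 hy) (hr.trans hp.symm)
      simp [hh.ne'] at this
    have hne2 : r ≠ swapIdx l := by
      rintro rfl
      have := hinj (ball1 hu) (ball1 hz) (hr.trans hq.symm)
      simp [hh.ne'] at this
    have hr3 : r < 3 := (by decide : ∀ l r : Fin 5, 3 ≤ l → r ≠ l → r ≠ swapIdx l → r < 3)
      l r hp3 hne1 hne2
    obtain ⟨j, -, hj, -, -, hjs, -⟩ := square hu hy huv hyv (by simp [hh.ne']) (by simp [hh.ne'])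
      hr hp
    rw [hjs hr3] at hj
    exact hlab _ (ball1 hu) _ (ball2 hu huv) _ hj

/-- Along a fibre containing a good vertex the labels are determined by parity. -/
lemma LabelledBallIso.fibre_alternates {V : Type*} {H : SimpleGraph V}
    {m : V × ZMod 4 → V × ZMod 4 → Option Γp} {h : V} {i : ZMod 4} {R : ℕ} (hR : 4 ≤ R)
    (hg : LabelledBallIso (H □ C4) m (h, i) (cayley SΓ) (cayleyLabel SΓ) 1 R) :
    ∃ k : Fin 5, 3 ≤ k ∧ ∀ j : ZMod 4, m (h, j) (h, j + 1) =
      some (gen (if j = 0 ∨ j = 2 then k else swapIdx k)) := by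
  obtain ⟨k, hk, h0, h1, h2, h3, -⟩ := hg.fibre_labels hR
  have hsk : 3 ≤ swapIdx k := (by decide : ∀ k : Fin 5, 3 ≤ k → 3 ≤ swapIdx k) k hk
  have main : ∀ d : ZMod 4, m (h, i + d) (h, i + d + 1) =
      some (gen (if d = 0 ∨ d = 2 then k else swapIdx k)) := by
    have hd : ∀ d : ZMod 4, d = 0 ∨ d = 1 ∨ d = 2 ∨ d = 3 := by decide
    intro d
    rw [add_assoc]
    rcases hd d with rfl | rfl | rfl | rfl
    · rw [if_pos (by decide), add_zero, zero_add, h0]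
    · rw [if_neg (by decide), show (1 : ZMod 4) + 1 = 2 from rfl, h1]
    · rw [if_pos (by decide), show (2 : ZMod 4) + 1 = 3 from rfl, h2]
    · rw [if_neg (by decide), show (3 : ZMod 4) + 1 = 0 from rfl, add_zero, h3]
  refine ⟨if i = 0 ∨ i = 2 then k else swapIdx k, by split_ifs <;> assumption, fun j => ?_⟩
  have := main (j - i)
  rw [add_sub_cancel] at this
  rw [this]
  congr 2
  clear this main h0 h1 h2 h3 hg
  revert i j k
  decide

/-- Vertices of `H` whose fibre contains a good vertex and whose first fibre edge is labelled `k`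
form an independent set. -/
lemma not_adj_of_fibre_label_eq {V : Type*} {H : SimpleGraph V}
    {m : V × ZMod 4 → V × ZMod 4 → Option Γp} {h h' : V} {i i' : ZMod 4} {R : ℕ} (hR : 4 ≤ R)
    (hg : LabelledBallIso (H □ C4) m (h, i) (cayley SΓ) (cayleyLabel SΓ) 1 R)
    (hg' : LabelledBallIso (H □ C4) m (h', i') (cayley SΓ) (cayleyLabel SΓ) 1 R)
    (heq : m (h, 0) (h, 1) = m (h', 0) (h', 1)) : ¬ H.Adj h h' := by
  intro hh
  obtain ⟨k, hk, h0, -, -, -, hn⟩ := hg.fibre_labels hR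
  obtain ⟨p, -, hp⟩ := hg.fibre_alternates hR
  obtain ⟨q, -, hq⟩ := hg'.fibre_alternates hR
  have hp0 := hp 0
  have hq0 := hq 0
  simp only [zero_add, true_or, if_true] at hp0 hq0
  have hpq : p = q := gen_injective (by simpa [hp0, hq0] using heq)
  have := hn h' hh
  rw [hq, ← hpq, ← hp, h0, Option.some_inj] at this
  exact (by decide : ∀ k : Fin 5, 3 ≤ k → k ≠ swapIdx k) k hk (gen_injective this)

/-- Let `Γ = ⟨a,b,c,d | b², c², d², cdcd, ada⁻¹c, aca⁻¹d, bcbd⟩`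
with generating set `S = {a, a⁻¹, b, c, d}`. Let `ε > 0`, let `H` be a finite
3-regular graph in which every independent set has at most `(1/2 − ε)·|V(H)|`
vertices, and let `ℓ` be any `S`-diagram structure on `H □ C₄`. Then for every
`R ≥ 4`, the number of `R`-good vertices of `H □ C₄` — those admitting a rooted
labelled-isomorphism from the labelled rooted `R`-ball of `(H □ C₄, ℓ)` to the
labelled rooted `R`-ball of the Cayley diagram of `(Γ, S)` at the identity — is
at most `(1 − 2ε)·|V(H □ C₄)|`. -/
theorem stmt_8 {V : Type} [Fintype V] (ε : ℝ) (hε : 0 < ε) (H : SimpleGraph V)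
    (hdeg : ∀ v : V, (H.neighborSet v).ncard = 3)
    (hind : ∀ s : Finset V, (∀ x ∈ s, ∀ y ∈ s, ¬ H.Adj x y) →
      (s.card : ℝ) ≤ (1 / 2 - ε) * Fintype.card V)
    (ℓ : DiagramStruct (H □ C4) SΓ) (R : ℕ) (hR : 4 ≤ R) :
    (Nat.card {x : V × ZMod 4 // LabelledBallIso (H □ C4) ℓ.label x
        (cayley SΓ) (cayleyLabel SΓ) 1 R} : ℝ)
      ≤ (1 - 2 * ε) * Fintype.card (V × ZMod 4) := by
  let good (x : V × ZMod 4) : Prop :=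
    LabelledBallIso (H □ C4) ℓ.label x (cayley SΓ) (cayleyLabel SΓ) 1 R
  let A (k : Fin 5) : Finset V :=
    Finset.univ.filter fun h => (∃ i, good (h, i)) ∧ ℓ.label (h, 0) (h, 1) = some (gen k)
  have hA (k : Fin 5) : ((A k).card : ℝ) ≤ (1 / 2 - ε) * Fintype.card V := by
    refine hind _ fun x hx y hy => ?_
    simp only [A, Finset.mem_filter, Finset.mem_univ, true_and] at hx hy
    obtain ⟨⟨i, hi⟩, hx⟩ := hx
    obtain ⟨⟨j, hj⟩, hy⟩ := hy
    exact not_adj_of_fibre_label_eq hR hi hj (hx.trans hy.symm)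
  have hsub : Finset.univ.filter good ⊆ (A 3 ∪ A 4) ×ˢ Finset.univ := by
    rintro ⟨h, i⟩ hx
    have hg : good (h, i) := by simpa using hx
    obtain ⟨k, hk, hlab⟩ := hg.fibre_alternates hR
    have h0 := hlab 0
    simp only [zero_add, true_or, if_true] at h0
    have hk' : k = 3 ∨ k = 4 := (by decide : ∀ k : Fin 5, 3 ≤ k → k = 3 ∨ k = 4) k hk
    simp only [A, Finset.mem_product, Finset.mem_union, Finset.mem_filter, Finset.mem_univ,
      true_and, and_true]
    rcases hk' with rfl | rfl
    · exact Or.inl ⟨⟨i, hg⟩, h0⟩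
    · exact Or.inr ⟨⟨i, hg⟩, h0⟩
  have hcard : (Finset.univ.filter good).card ≤ ((A 3).card + (A 4).card) * 4 := by
    refine (Finset.card_le_card hsub).trans ?_
    rw [Finset.card_product, Finset.card_univ, ZMod.card]
    exact Nat.mul_le_mul_right _ (Finset.card_union_le _ _)
  have hcard' : ((Finset.univ.filter good).card : ℝ) ≤ ((A 3).card + (A 4).card) * 4 := by
    exact_mod_cast hcard
  rw [Nat.card_eq_fintype_card, Fintype.card_subtype, Fintype.card_prod, ZMod.card]
  push_cast
  linarith [hA 3, hA 4]
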